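/- For every k ≥ 2, there is no continuous Z/2-equivariant map from the sphere S^{2k} to the deleted square of the (k+1)-dimensional skeleton of the (2k+1)-dimensional simplex, where Z/2 acts antipodally on the sphere and by swapping factors on the deleted square. -/

import Mathlib

open Set

/-- The geometric realization of the deleted square `K²_δ` of the `d`-dimensional
skeleton `K` of the simplex on the vertex set `Fin m`: pairs of points of the
standard simplex supported on two disjoint faces, each with at most `d + 1`
vertices. -/
def deletedSquare (m d : ℕ) : Set ((Fin m → ℝ) × (Fin m → ℝ)) :=
  {p | p.1 ∈ stdSimplex ℝ (Fin m) ∧ p.2 ∈ stdSimplex ℝ (Fin m) ∧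
    Disjoint (Function.support p.1) (Function.support p.2) ∧
    (Function.support p.1).ncard ≤ d + 1 ∧ (Function.support p.2).ncard ≤ d + 1}

namespace WordChain

/-- Mod 2 chains of ordered simplices on a vertex set `V`, the empty word being the
generator of the augmentation degree. -/
abbrev Chain (V : Type*) := List V →₀ ZMod 2

/-- A chain all of whose words satisfy `P`. -/
abbrev IsOn {V : Type*} (P : List V → Prop) (c : Chain V) : Prop :=
  c ∈ Finsupp.supported (ZMod 2) (ZMod 2) {w | P w}

/-- The linear extension of a function on words. -/
noncomputable abbrev extend {V M : Type*} [AddCommGroup M] [Module (ZMod 2) M]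
    (g : List V → M) : Chain V →ₗ[ZMod 2] M :=
  Finsupp.linearCombination (ZMod 2) g

section Basic

variable {V W M : Type*} [AddCommGroup M] [Module (ZMod 2) M]

lemma isOn_single {P : List V → Prop} {w : List V} (h : P w) (a : ZMod 2) :
    IsOn P (Finsupp.single w a) :=
  Finsupp.single_mem_supported _ _ h

lemma IsOn.mono {P Q : List V → Prop} (h : ∀ w, P w → Q w) {c : Chain V} (hc : IsOn P c) :
    IsOn Q c :=
  Finsupp.supported_mono (fun w hw => h w hw) hc

lemma IsOn.and {P Q : List V → Prop} {c : Chain V} (hP : IsOn P c) (hQ : IsOn Q c) :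
    IsOn (fun w => P w ∧ Q w) c :=
  fun _ hw => ⟨hP hw, hQ hw⟩

lemma map_mem {P : List V → Prop} {f : Chain V →ₗ[ZMod 2] M} {S : Submodule (ZMod 2) M}
    (h : ∀ w, P w → f (Finsupp.single w 1) ∈ S) {c : Chain V} (hc : IsOn P c) : f c ∈ S := by
  rw [← Finsupp.sum_single c, Finsupp.sum, map_sum]
  refine Submodule.sum_mem _ fun w hw => ?_
  rw [show Finsupp.single w (c w) = c w • Finsupp.single w 1 by simp, map_smul]
  exact S.smul_mem _ (h w ((Finsupp.mem_supported _ _).1 hc hw))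

lemma eq_of_eq_on {P : List V → Prop} {f g : Chain V →ₗ[ZMod 2] M}
    (h : ∀ w, P w → f (Finsupp.single w 1) = g (Finsupp.single w 1))
    {c : Chain V} (hc : IsOn P c) : f c = g c := by
  have key : (f - g) c ∈ (⊥ : Submodule (ZMod 2) M) := map_mem (fun w hw => by simp [h w hw]) hc
  rw [Submodule.mem_bot, LinearMap.sub_apply] at key
  exact sub_eq_zero.1 key

/-- The cone with apex `v`. -/
noncomputable def cone (v : V) : Chain V →ₗ[ZMod 2] Chain V :=
  extend fun w => Finsupp.single (v :: w) 1

@[simp] lemma cone_single (v : V) (w : List V) :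
    cone v (Finsupp.single w 1) = Finsupp.single (v :: w) 1 := by
  simp [cone]

/-- The sum of the codimension one faces of a word. -/
noncomputable def faces : List V → Chain V
  | [] => 0
  | v :: w => Finsupp.single w 1 + cone v (faces w)

/-- The (augmented) boundary operator. -/
noncomputable def bd : Chain V →ₗ[ZMod 2] Chain V := extend faces

@[simp] lemma bd_single (w : List V) : bd (Finsupp.single w 1) = faces w := by
  simp [bd]

lemma bd_cone (v : V) (c : Chain V) : bd (cone v c) = c + cone v (bd c) := by
  have : bd ∘ₗ cone v = LinearMap.id + cone v ∘ₗ bd := by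
    ext1 w
    ext1
    simp [faces]
  exact congrArg (· c) this

lemma add_self_chain (c : M) : c + c = 0 := by
  rw [← two_smul (ZMod 2) c, show (2 : ZMod 2) = 0 from rfl, zero_smul]

lemma bd_faces (w : List V) : bd (faces w) = 0 := by
  induction w with
  | nil => simp [faces]
  | cons v w ih => simp [faces, bd_cone, ih, add_self_chain]

lemma isOn_faces (w : List V) :
    IsOn (fun u => u.Sublist w ∧ u.length + 1 = w.length) (faces w) := by
  induction w with
  | nil => exact Submodule.zero_mem _
  | cons v w ih =>
    refine Submodule.add_mem _ (isOn_single ⟨List.sublist_cons_self v w, rfl⟩ _) ?_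
    refine map_mem (fun u hu => ?_) ih
    rw [cone_single]
    exact isOn_single ⟨hu.1.cons_cons v, by simp [hu.2]⟩ _

/-- The map induced on chains by a map of vertices. -/
noncomputable def map (f : V → W) : Chain V →ₗ[ZMod 2] Chain W :=
  extend fun w => Finsupp.single (w.map f) 1

@[simp] lemma map_single (f : V → W) (w : List V) :
    map f (Finsupp.single w 1) = Finsupp.single (w.map f) 1 := by
  simp [map]

lemma map_cone (f : V → W) (v : V) (c : Chain V) :
    map f (cone v c) = cone (f v) (map f c) := by
  have : map f ∘ₗ cone v = cone (f v) ∘ₗ map f := by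
    ext1 w
    ext1
    simp
  exact congrArg (· c) this

lemma faces_map (f : V → W) (w : List V) : faces (w.map f) = map f (faces w) := by
  induction w with
  | nil => simp [faces]
  | cons v w ih => simp [faces, map_cone, ih]

lemma bd_map (f : V → W) (c : Chain V) : bd (map f c) = map f (bd c) := by
  have : bd ∘ₗ map f = map f ∘ₗ bd := by
    ext1 w
    ext1
    simp [faces_map]
  exact congrArg (· c) this

lemma map_involutive {f : V → V} (hf : Function.Involutive f) (c : Chain V) :
    map f (map f c) = c := by
  have : map f ∘ₗ map f = LinearMap.id := by
    ext1 w
    ext1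
    simp [hf.comp_self]
  exact congrArg (· c) this

end Basic

/-- The antipode on chains. -/
noncomputable abbrev anti {V : Type*} [Neg V] : Chain V →ₗ[ZMod 2] Chain V := map Neg.neg

lemma anti_anti {V : Type*} [InvolutiveNeg V] (c : Chain V) : anti (anti c) = c :=
  map_involutive neg_involutive c

section Subdivision

variable {E : Type*} [NormedAddCommGroup E] [NormedSpace ℝ E]

/-- The barycenter of a word. -/
noncomputable def bary (w : List E) : E := (w.length : ℝ)⁻¹ • w.sum

lemma bary_map_neg (w : List E) : bary (w.map Neg.neg) = -bary w := by
  have : (w.map Neg.neg).sum = -w.sum := by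
    induction w with
    | nil => simp
    | cons v w ih => simp [ih, add_comm]
  rw [bary, this, List.length_map, smul_neg, bary]

lemma bary_eq_sum (w : List E) : bary w = ∑ i : Fin w.length, (w.length : ℝ)⁻¹ • w[i] := by
  rw [bary, ← Finset.smul_sum]
  congr 1
  exact (Fin.sum_univ_getElem w).symm

lemma bary_mem {A : Set E} (hA : Convex ℝ A) {w : List E} (hw : w ≠ []) (h : ∀ v ∈ w, v ∈ A) :
    bary w ∈ A := by
  have hl : (w.length : ℝ) ≠ 0 := by simpa using hw
  rw [bary_eq_sum]
  refine hA.sum_mem (fun i _ => by positivity) ?_ (fun i _ => h _ (List.getElem_mem _))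
  simp [hl]

lemma dist_bary_le {w : List E} {D : ℝ} (h : ∀ u ∈ w, ∀ v ∈ w, dist u v ≤ D)
    {v : E} (hv : v ∈ w) : dist v (bary w) ≤ (1 - (w.length : ℝ)⁻¹) * D := by
  obtain ⟨j, hj, rfl⟩ := List.getElem_of_mem hv
  have hl : (w.length : ℝ) ≠ 0 := by
    have : 0 < w.length := by omega
    positivity
  have e : bary w - w[j] = ∑ i : Fin w.length, (w.length : ℝ)⁻¹ • (w[i] - w[j]) := by
    simp_rw [smul_sub]
    rw [Finset.sum_sub_distrib, ← bary_eq_sum]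
    simp [← Nat.cast_smul_eq_nsmul ℝ, smul_smul, hl]
  rw [dist_comm, dist_eq_norm, e,
    ← Finset.add_sum_erase _ _ (Finset.mem_univ (⟨j, hj⟩ : Fin w.length))]
  simp only [Fin.getElem_fin, sub_self, smul_zero, zero_add]
  refine (norm_sum_le_of_le _ (f := fun i : Fin w.length => (w.length : ℝ)⁻¹ • (w[i] - w[j]))
    (n := fun _ => (w.length : ℝ)⁻¹ * D) fun i _ => ?_).trans ?_
  · rw [norm_smul, norm_inv, Real.norm_natCast, ← dist_eq_norm]
    gcongr
    exact h _ (List.getElem_mem _) _ hv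
  · have h1 : 1 ≤ w.length := by omega
    simp only [Finset.sum_const, Finset.card_erase_of_mem (Finset.mem_univ _), Finset.card_univ,
      Fintype.card_fin, nsmul_eq_mul, Nat.cast_sub h1, Nat.cast_one]
    apply le_of_eq
    field_simp

/-- Barycentric subdivision of chains of words of length `k`. -/
noncomputable def sd : ℕ → Chain E →ₗ[ZMod 2] Chain E
  | 0 => LinearMap.id
  | k + 1 => extend fun w => cone (bary w) (sd k (faces w))

@[simp] lemma sd_succ_single (k : ℕ) (w : List E) :
    sd (k + 1) (Finsupp.single w 1) = cone (bary w) (sd k (faces w)) := by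
  simp [sd]

lemma bd_sd (k : ℕ) (c : Chain E) : bd (sd (k + 1) c) = sd k (bd c) := by
  induction k generalizing c with
  | zero =>
    have : bd ∘ₗ sd 1 = sd 0 ∘ₗ (bd : Chain E →ₗ[ZMod 2] Chain E) := by
      ext1 w
      ext1
      simp [bd_cone, sd, bd_faces]
    exact congrArg (· c) this
  | succ k ih =>
    have : bd ∘ₗ sd (k + 2) = sd (k + 1) ∘ₗ (bd : Chain E →ₗ[ZMod 2] Chain E) := by
      ext1 w
      ext1
      simp [bd_cone, ih, bd_faces]
    exact congrArg (· c) this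

lemma anti_sd (k : ℕ) (c : Chain E) : anti (sd k c) = sd k (anti c) := by
  induction k generalizing c with
  | zero => rfl
  | succ k ih =>
    have : anti ∘ₗ sd (k + 1) = sd (k + 1) ∘ₗ (anti : Chain E →ₗ[ZMod 2] Chain E) := by
      ext1 w
      ext1
      simp [map_cone, ih, faces_map, bary_map_neg]
    exact congrArg (· c) this

lemma isOn_sd_of_convex {A : Set E} (hA : Convex ℝ A) (k : ℕ) {w : List E}
    (hl : w.length = k) (hw : ∀ v ∈ w, v ∈ A) :
    IsOn (fun u => u.length = k ∧ ∀ v ∈ u, v ∈ A) (sd k (Finsupp.single w 1)) := by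
  induction k generalizing w with
  | zero => exact isOn_single ⟨hl, hw⟩ _
  | succ k ih =>
    rw [sd_succ_single]
    have hb : bary w ∈ A := bary_mem hA (by rintro rfl; simp at hl) hw
    have h1 : IsOn (fun u => u.length = k ∧ ∀ v ∈ u, v ∈ A) (sd k (faces w)) :=
      map_mem (fun u hu => ih (by omega) fun v hv => hw v (hu.1.subset hv)) (isOn_faces w)
    refine map_mem (fun u hu => ?_) h1
    rw [cone_single]
    exact isOn_single ⟨by simp [hu.1], by simpa [hb] using hu.2⟩ _

lemma isOn_sd_of_dist_le {m : ℕ} {D : ℝ} (hD : 0 ≤ D) (k : ℕ) (hk : k ≤ m) {w : List E}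
    (hl : w.length = k) (hw : ∀ u ∈ w, ∀ v ∈ w, dist u v ≤ D) :
    IsOn (fun x => ∀ u ∈ x, ∀ v ∈ x, dist u v ≤ (1 - (m : ℝ)⁻¹) * D)
      (sd k (Finsupp.single w 1)) := by
  induction k generalizing w with
  | zero =>
    obtain rfl := List.length_eq_zero_iff.1 hl
    exact isOn_single (by simp) _
  | succ k ih =>
    rw [sd_succ_single]
    have hr : (1 - (w.length : ℝ)⁻¹) * D ≤ (1 - (m : ℝ)⁻¹) * D := by
      rw [hl]
      gcongr
    have hm : (0 : ℝ) ≤ (1 - (m : ℝ)⁻¹) * D := by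
      refine mul_nonneg (sub_nonneg.2 (inv_le_one_of_one_le₀ ?_)) hD
      exact_mod_cast (by omega : 1 ≤ m)
    have h1 : IsOn (fun x => ∀ u ∈ x, ∀ v ∈ x, dist u v ≤ (1 - (m : ℝ)⁻¹) * D)
        (sd k (faces w)) :=
      map_mem (fun u hu => ih (by omega) (by omega)
        fun a ha b hb => hw a (hu.1.subset ha) b (hu.1.subset hb)) (isOn_faces w)
    have h2 : IsOn (fun x => x.length = k ∧
        ∀ u ∈ x, u ∈ Metric.closedBall (bary w) ((1 - (m : ℝ)⁻¹) * D)) (sd k (faces w)) :=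
      map_mem (fun u hu => isOn_sd_of_convex (convex_closedBall _ _) k (by omega)
        fun a ha => (dist_bary_le hw (hu.1.subset ha)).trans hr) (isOn_faces w)
    refine map_mem (fun u hu => ?_) (h1.and h2)
    rw [cone_single]
    refine isOn_single ?_ _
    simp only [List.mem_cons, forall_eq_or_imp, dist_self, hm, true_and]
    exact ⟨fun a ha => by simpa [dist_comm] using hu.2.2 a ha,
      fun a ha => ⟨hu.2.2 a ha, hu.1 a ha⟩⟩

end Subdivision

section Labels

/-- The first entry of maximal absolute value, and `0` for the empty list. -/
def top : List ℤ → ℤ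
  | [] => 0
  | a :: w => if |a| < |top w| then top w else a

lemma top_map_neg (w : List ℤ) : top (w.map Neg.neg) = -top w := by
  induction w with
  | nil => simp [top]
  | cons a w ih =>
    simp only [List.map_cons, top, ih, abs_neg]
    split_ifs <;> rfl

lemma abs_le_abs_top {w : List ℤ} {a : ℤ} (ha : a ∈ w) : |a| ≤ |top w| := by
  induction w with
  | nil => simp at ha
  | cons b w ih =>
    rw [top]
    rcases List.mem_cons.1 ha with rfl | h
    · split_ifs with h' <;> omega
    · have := ih h
      split_ifs with h' <;> omega

lemma top_mem {w : List ℤ} (hw : w ≠ []) : top w ∈ w := by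
  induction w with
  | nil => simp at hw
  | cons b w ih =>
    rw [top]
    split_ifs with h
    · refine List.mem_cons_of_mem _ (ih ?_)
      rintro rfl
      simp only [top, abs_zero] at h
      exact absurd h (abs_nonneg b).not_gt
    · exact List.mem_cons_self

lemma top_ne_zero {w : List ℤ} (hw : w ≠ []) (h : ∀ a ∈ w, a ≠ 0) : top w ≠ 0 :=
  h _ (top_mem hw)

/-- The cochain of degree `k` counting, modulo 2, the flags of faces of a word along which the sign
of the dominant label alternates, the whole word being positive. -/
noncomputable def altCount : ℕ → Chain ℤ →ₗ[ZMod 2] ZMod 2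
  | 0 => extend fun _ => 1
  | k + 1 => extend fun w => (if 0 < top w then 1 else 0) * altCount k (anti (faces w))

@[simp] lemma altCount_zero_single (w : List ℤ) : altCount 0 (Finsupp.single w 1) = 1 := by
  simp [altCount]

@[simp] lemma altCount_succ_single (k : ℕ) (w : List ℤ) :
    altCount (k + 1) (Finsupp.single w 1) =
      (if 0 < top w then 1 else 0) * altCount k (anti (faces w)) := by
  simp [altCount]

lemma altCount_zero_add_anti (c : Chain ℤ) : altCount 0 c + altCount 0 (anti c) = 0 := by
  have : altCount 0 + altCount 0 ∘ₗ anti = 0 := by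
    ext1 w
    ext1
    simpa using add_self_chain (1 : ZMod 2)
  exact congrArg (· c) this

lemma altCount_bd (k : ℕ) {c : Chain ℤ} (hc : IsOn (fun w => ∀ a ∈ w, a ≠ 0) c) :
    altCount k (bd c) = altCount (k + 1) c + altCount (k + 1) (anti c) := by
  refine eq_of_eq_on (f := altCount k ∘ₗ bd)
    (g := altCount (k + 1) + altCount (k + 1) ∘ₗ anti) (fun w hw => ?_) hc
  have hf : altCount k (faces w) + altCount k (anti (faces w)) = 0 := by
    match k with
    | 0 => exact altCount_zero_add_anti _
    | k + 1 =>
      rw [← altCount_bd k, bd_faces, map_zero]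
      exact (isOn_faces w).mono fun u hu a ha => hw a (hu.1.subset ha)
  have hf' : altCount k (anti (faces w)) = altCount k (faces w) := by
    rw [← sub_eq_zero, CharTwo.sub_eq_add, add_comm, hf]
  simp only [LinearMap.comp_apply, LinearMap.add_apply, bd_single, altCount_succ_single,
    map_single, faces_map, anti_anti, hf', top_map_neg]
  rcases eq_or_ne w [] with rfl | hne
  · simp [faces]
  · rcases (top_ne_zero hne hw).lt_or_gt with h | h
    · simp [h, h.not_gt]
    · simp [h, h.not_gt]

lemma le_top_of_altCount_ne_zero (k : ℕ) {w : List ℤ} (hl : w.length = k)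
    (hw : ∀ a ∈ w, ∀ b ∈ w, a + b ≠ 0) (h : altCount k (Finsupp.single w 1) ≠ 0) :
    (k : ℤ) ≤ top w := by
  induction k generalizing w with
  | zero =>
    obtain rfl := List.length_eq_zero_iff.1 hl
    simp [top]
  | succ k ih =>
    rw [altCount_succ_single] at h
    have hpos : 0 < top w := by
      by_contra h'
      simp [h'] at h
    by_contra hlt
    apply right_ne_zero_of_mul h
    rw [← Submodule.mem_bot (ZMod 2)]
    refine map_mem (f := altCount k ∘ₗ anti) (fun u hu => ?_) (isOn_faces w)
    rw [Submodule.mem_bot, LinearMap.comp_apply, map_single]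
    by_contra hne
    have hk := ih (w := u.map Neg.neg) (by simp; omega) (by
      simp only [List.mem_map, forall_exists_index, and_imp, forall_apply_eq_imp_iff₂]
      intro a ha b hb hab
      exact hw a (hu.1.subset ha) b (hu.1.subset hb) (by omega)) hne
    rw [top_map_neg] at hk
    rcases eq_or_ne u [] with rfl | hu'
    · have : k = 0 := by simpa [hl] using hu.2.symm
      subst this
      push_cast at hlt
      omega
    · have hmem := hu.1.subset (top_mem hu')
      have h1 := abs_le_abs_top hmem
      refine hw _ hmem _ (top_mem (w := w) (by rintro rfl; simp at hl)) ?_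
      push_cast at hlt
      rw [abs_of_pos hpos] at h1
      have := neg_abs_le (top u)
      omega

end Labels

section Spheres

variable {E : Type*} [InvolutiveNeg E]

/-- The fundamental cycle of the boundary of the cross-polytope with vertices `± e i`, `i < k`. -/
noncomputable def sphere (e : ℕ → E) : ℕ → Chain E
  | 0 => Finsupp.single [] 1
  | k + 1 => cone (e k) (sphere e k) + anti (cone (e k) (sphere e k))

lemma anti_sphere (e : ℕ → E) (k : ℕ) : anti (sphere e k) = sphere e k := by
  cases k with
  | zero => simp [sphere]
  | succ k => rw [sphere, map_add, anti_anti, add_comm]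

lemma bd_sphere (e : ℕ → E) (k : ℕ) : bd (sphere e k) = 0 := by
  induction k with
  | zero => simp [sphere, faces]
  | succ k ih => simp [sphere, bd_map, bd_cone, ih, anti_sphere, add_self_chain]

lemma map_anti {lab : E → ℤ} (hodd : ∀ v, lab (-v) = -lab v) (c : Chain E) :
    map lab (anti c) = anti (map lab c) := by
  have : map lab ∘ₗ anti = anti ∘ₗ map lab := by
    ext1 w
    ext1
    simp [Function.comp_def, hodd]
  exact congrArg (· c) this

end Spheres

section AlternatingFlags

variable {E : Type*} [NormedAddCommGroup E] [NormedSpace ℝ E]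

lemma bd_sd_iterate (N k : ℕ) (c : Chain E) :
    bd ((sd (k + 1))^[N] c) = (sd k)^[N] (bd c) :=
  Function.Semiconj.iterate_right (f := bd) (fun c => bd_sd k c) N c

lemma anti_sd_iterate (N k : ℕ) (c : Chain E) : anti ((sd k)^[N] c) = (sd k)^[N] (anti c) :=
  Function.Semiconj.iterate_right (f := anti) (fun c => anti_sd k c) N c

lemma sd_iterate_add (N k : ℕ) (c d : Chain E) :
    (sd k)^[N] (c + d) = (sd k)^[N] c + (sd k)^[N] d := by
  rw [← Module.End.pow_apply, ← Module.End.pow_apply, ← Module.End.pow_apply, map_add]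

/-- The number of alternating flags in a subdivided cross-polytope boundary is odd. -/
lemma altCount_sphere {lab : E → ℤ} (hodd : ∀ v, lab (-v) = -lab v) (e : ℕ → E) (N m : ℕ)
    (h : ∀ k < m, IsOn (fun w => ∀ v ∈ w, lab v ≠ 0)
      ((sd (k + 1))^[N] (cone (e k) (sphere e k)))) :
    altCount m (map lab ((sd m)^[N] (sphere e m))) = 1 := by
  induction m with
  | zero =>
    have : (sd 0 : Chain E →ₗ[ZMod 2] Chain E)^[N] = id := Function.iterate_id N
    rw [this]
    simp [sphere]
  | succ k ih =>
    rw [sphere, sd_iterate_add, map_add, map_add, ← anti_sd_iterate, map_anti hodd,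
      ← altCount_bd, bd_map, bd_sd_iterate, bd_cone, bd_sphere, map_zero, add_zero]
    · exact ih fun j hj => h j (by omega)
    · refine map_mem (fun w hw => ?_) (h k (by omega))
      rw [map_single]
      exact isOn_single (by simpa using hw) _

end AlternatingFlags

end WordChain

section CrossPolytope

open WordChain

variable {n : ℕ}

local notation "𝔼" => EuclideanSpace ℝ (Fin (n + 1))

/-- The facet of the cross-polytope with sign vector `σ`. -/
def orthantFace (σ : Fin (n + 1) → ℝ) : Set 𝔼 :=
  {x | (∀ i, 0 ≤ σ i * x i) ∧ ∑ i, σ i * x i = 1}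

lemma convex_orthantFace (σ : Fin (n + 1) → ℝ) : Convex ℝ (orthantFace σ) := by
  rintro x ⟨hx, hx'⟩ y ⟨hy, hy'⟩ a b ha hb hab
  refine ⟨fun i => ?_, ?_⟩
  · have := add_nonneg (mul_nonneg ha (hx i)) (mul_nonneg hb (hy i))
    simp only [PiLp.add_apply, PiLp.smul_apply, smul_eq_mul]
    linarith
  · have : ∀ i, σ i * (a • x + b • y) i = a * (σ i * x i) + b * (σ i * y i) := fun i => by
      simp only [PiLp.add_apply, PiLp.smul_apply, smul_eq_mul]
      ring
    simp only [this, Finset.sum_add_distrib, ← Finset.mul_sum, hx', hy', mul_one, hab]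

variable (n) in
/-- The boundary of the cross-polytope. -/
def crossSphere : Set 𝔼 := {x | ∑ i, |x i| = 1}

lemma isCompact_crossSphere : IsCompact (crossSphere n) := by
  refine Metric.isCompact_of_isClosed_isBounded
    (isClosed_eq (by fun_prop) continuous_const) ?_
  refine (Metric.isBounded_closedBall (x := (0 : 𝔼)) (r := 1)).subset fun x hx => ?_
  rw [mem_closedBall_zero_iff, EuclideanSpace.norm_eq, ← Real.sqrt_one]
  refine Real.sqrt_le_sqrt ?_
  have h1 : ∀ i, |x i| ≤ 1 := fun i =>
    (Finset.single_le_sum (fun j _ => abs_nonneg (x j)) (Finset.mem_univ i)).trans_eq hx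
  calc ∑ i, ‖x i‖ ^ 2 ≤ ∑ i, |x i| := Finset.sum_le_sum fun i _ => by
        rw [Real.norm_eq_abs]
        nlinarith [h1 i, abs_nonneg (x i)]
    _ = 1 := hx

lemma ne_zero_of_mem_crossSphere {x : 𝔼} (hx : x ∈ crossSphere n) : x ≠ 0 := by
  rintro rfl
  simp [crossSphere] at hx

lemma orthantFace_subset_crossSphere {σ : Fin (n + 1) → ℝ} (hσ : ∀ i, |σ i| = 1) :
    orthantFace σ ⊆ crossSphere n := by
  rintro x ⟨h0, h1⟩
  change ∑ i, |x i| = 1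
  rw [← h1]
  refine Finset.sum_congr rfl fun i _ => ?_
  rw [← abs_of_nonneg (h0 i), abs_mul, hσ, one_mul]

/-- Words of length `k` and mesh at most `D` whose vertices lie in a common facet of the
cross-polytope. -/
def IsFacetWord (k : ℕ) (D : ℝ) (w : List 𝔼) : Prop :=
  w.length = k ∧ (∃ σ : Fin (n + 1) → ℝ, (∀ i, |σ i| = 1) ∧ ∀ v ∈ w, v ∈ orthantFace σ) ∧
    ∀ u ∈ w, ∀ v ∈ w, dist u v ≤ D

lemma IsFacetWord.mem_crossSphere {k : ℕ} {D : ℝ} {w : List 𝔼} (h : IsFacetWord k D w)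
    {v : 𝔼} (hv : v ∈ w) : v ∈ crossSphere n := by
  obtain ⟨-, ⟨σ, hσ, hw⟩, -⟩ := h
  exact orthantFace_subset_crossSphere hσ (hw v hv)

lemma isOn_sd_iterate {m k : ℕ} (hk : k ≤ m) {D : ℝ} (hD : 0 ≤ D)
    {c : Chain 𝔼} (hc : IsOn (IsFacetWord k D) c) (N : ℕ) :
    IsOn (IsFacetWord k ((1 - (m : ℝ)⁻¹) ^ N * D)) ((sd k)^[N] c) := by
  have hr : 0 ≤ 1 - (m : ℝ)⁻¹ := sub_nonneg.2 (Nat.cast_inv_le_one m)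
  induction N with
  | zero => simpa using hc
  | succ N ih =>
    rw [Function.iterate_succ_apply']
    refine map_mem (fun w hw => ?_) ih
    obtain ⟨hl, ⟨σ, hσ, hw1⟩, hw2⟩ := hw
    have h1 := isOn_sd_of_convex (convex_orthantFace σ) k hl hw1
    have h2 := isOn_sd_of_dist_le (by positivity) k hk hl hw2
    refine (h1.and h2).mono fun u hu => ⟨hu.1.1, ⟨σ, hσ, hu.1.2⟩, fun a ha b hb => ?_⟩
    exact (hu.2 a ha b hb).trans_eq (by ring)

variable (n) in
/-- The standard basis vectors, indexed by `ℕ`. -/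
noncomputable def stdVec (k : ℕ) : 𝔼 :=
  if h : k < n + 1 then EuclideanSpace.single ⟨k, h⟩ 1 else 0

/-- Words of length `k` with entries among `± e i`, `i < k`, without opposite entries. -/
def IsVertexWord (k : ℕ) (w : List 𝔼) : Prop :=
  w.length = k ∧ ∃ σ : Fin (n + 1) → ℝ, (∀ i, |σ i| = 1) ∧
    ∀ v ∈ w, ∃ i : Fin (n + 1), (i : ℕ) < k ∧ v = EuclideanSpace.single i (σ i)

lemma IsVertexWord.cons {k : ℕ} (hk : k < n + 1) {w : List 𝔼} (hw : IsVertexWord k w) :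
    IsVertexWord (k + 1) (stdVec n k :: w) := by
  obtain ⟨hl, σ, hσ, h⟩ := hw
  refine ⟨by simp [hl], Function.update σ ⟨k, hk⟩ 1, fun i => ?_, fun v hv => ?_⟩
  · rcases eq_or_ne i ⟨k, hk⟩ with rfl | hi
    · simp
    · simp [hi, hσ]
  · rcases List.mem_cons.1 hv with rfl | hv
    · exact ⟨⟨k, hk⟩, by simp, by simp [stdVec, hk]⟩
    · obtain ⟨i, hi, rfl⟩ := h v hv
      refine ⟨i, by omega, ?_⟩
      rw [Function.update_of_ne]
      rintro rfl
      simp at hi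

lemma IsVertexWord.neg {k : ℕ} {w : List 𝔼} (hw : IsVertexWord k w) :
    IsVertexWord k (w.map Neg.neg) := by
  obtain ⟨hl, σ, hσ, h⟩ := hw
  refine ⟨by simp [hl], -σ, by simpa using hσ, fun v hv => ?_⟩
  obtain ⟨u, hu, rfl⟩ := List.mem_map.1 hv
  obtain ⟨i, hi, rfl⟩ := h u hu
  exact ⟨i, hi, by ext j; by_cases hj : j = i <;> simp [hj]⟩

lemma IsVertexWord.isFacetWord {k : ℕ} {w : List 𝔼} (hw : IsVertexWord k w) :
    IsFacetWord k (Metric.diam (crossSphere n)) w := by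
  obtain ⟨hl, σ, hσ, h⟩ := hw
  have hmem : ∀ v ∈ w, v ∈ orthantFace σ := by
    intro v hv
    obtain ⟨i, -, rfl⟩ := h v hv
    have hs : σ i * σ i = 1 := by rw [← abs_mul_abs_self, hσ, one_mul]
    refine ⟨fun j => ?_, ?_⟩
    · rcases eq_or_ne j i with rfl | hj
      · simp [hs]
      · simp [hj]
    · simp [hs]
  exact ⟨hl, ⟨σ, hσ, hmem⟩, fun u hu v hv => Metric.dist_le_diam_of_mem
    isCompact_crossSphere.isBounded (orthantFace_subset_crossSphere hσ (hmem u hu))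
    (orthantFace_subset_crossSphere hσ (hmem v hv))⟩

lemma isOn_cone_stdVec {k : ℕ} (hk : k < n + 1) {c : Chain 𝔼} (hc : IsOn (IsVertexWord k) c) :
    IsOn (IsVertexWord (k + 1)) (cone (stdVec n k) c) :=
  map_mem (fun w hw => by
    rw [cone_single]
    exact isOn_single (hw.cons hk) _) hc

lemma isOn_sphere {k : ℕ} (hk : k ≤ n + 1) :
    IsOn (IsVertexWord k) (sphere (stdVec n) k) := by
  induction k with
  | zero => exact isOn_single ⟨rfl, fun _ => 1, by simp, by simp⟩ _
  | succ k ih =>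
    have h := isOn_cone_stdVec hk (ih (by omega))
    refine Submodule.add_mem _ h (map_mem (fun w hw => ?_) h)
    rw [map_single]
    exact isOn_single hw.neg _

/-- **Tucker's lemma** for fine subdivisions of the cross-polytope. -/
lemma exists_opposite_labels {lab : 𝔼 → ℤ} (hodd : ∀ v, lab (-v) = -lab v)
    (h0 : ∀ v ∈ crossSphere n, lab v ≠ 0) (hn : ∀ v, lab v ≤ n) {δ : ℝ} (hδ : 0 < δ) :
    ∃ u ∈ crossSphere n, ∃ v ∈ crossSphere n, dist u v < δ ∧ lab u + lab v = 0 := by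
  by_contra! hcon
  have hr0 : (0 : ℝ) ≤ 1 - ((n + 1 : ℕ) : ℝ)⁻¹ := sub_nonneg.2 (Nat.cast_inv_le_one _)
  have hr1 : 1 - ((n + 1 : ℕ) : ℝ)⁻¹ < 1 := sub_lt_self _ (by positivity)
  obtain ⟨N, hN⟩ : ∃ N : ℕ,
      (1 - ((n + 1 : ℕ) : ℝ)⁻¹) ^ N * Metric.diam (crossSphere n) < δ := by
    have := (tendsto_pow_atTop_nhds_zero_of_lt_one hr0 hr1).mul_const
      (Metric.diam (crossSphere n))
    rw [zero_mul] at this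
    exact (this.eventually_lt_const hδ).exists
  have hone : altCount (n + 1) (map lab ((sd (n + 1))^[N] (sphere (stdVec n) (n + 1)))) = 1 := by
    refine altCount_sphere hodd (stdVec n) N (n + 1) fun k hk => ?_
    have h1 := (isOn_cone_stdVec hk (isOn_sphere hk.le)).mono fun w hw => hw.isFacetWord
    exact (isOn_sd_iterate (m := n + 1) hk Metric.diam_nonneg h1 N).mono
      fun w hw v hv => h0 v (hw.mem_crossSphere hv)
  have h1 := isOn_sd_iterate (m := n + 1) le_rfl Metric.diam_nonneg
    ((isOn_sphere (n := n) le_rfl).mono fun w hw => hw.isFacetWord) N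
  have hzero : (altCount (n + 1) ∘ₗ map lab) ((sd (n + 1))^[N] (sphere (stdVec n) (n + 1)))
      ∈ (⊥ : Submodule (ZMod 2) (ZMod 2)) := by
    refine map_mem (fun w hw => ?_) h1
    rw [Submodule.mem_bot, LinearMap.comp_apply, map_single]
    by_contra hne
    have hle := le_top_of_altCount_ne_zero (n + 1) (w := w.map lab) (by simp [hw.1]) (by
      simp only [List.mem_map, forall_exists_index, and_imp, forall_apply_eq_imp_iff₂]
      exact fun a ha b hb => hcon a (hw.mem_crossSphere ha) b (hw.mem_crossSphere hb)
        ((hw.2.2 a ha b hb).trans_lt hN)) hne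
    have hne' : w.map lab ≠ [] := by
      intro h
      have := congrArg List.length h
      simp [hw.1] at this
    obtain ⟨v, -, hv⟩ := List.mem_map.1 (top_mem hne')
    have := hn v
    rw [← hv] at hle
    push_cast at hle
    omega
  rw [Submodule.mem_bot, LinearMap.comp_apply, hone] at hzero
  exact one_ne_zero hzero

/-- There is an odd integer label on `ℝⁿ` which is, up to sign, the (shifted) position of a
coordinate of absolute value at least `ε`, and `0` if there is none. -/
lemma exists_odd_labelling (n : ℕ) {ε : ℝ} (hε : 0 < ε) :
    ∃ L : (Fin n → ℝ) → ℤ, (∀ y, L (-y) = -L y) ∧ (∀ y, L y ≤ n) ∧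
      (∀ y, (∃ i, ε ≤ |y i|) → L y ≠ 0) ∧
      ∀ y z, L y ≠ 0 → L y + L z = 0 → ∃ i, ε ≤ |y i - z i| := by
  classical
  let idx : (Fin n → ℝ) → Option (Fin n) := fun a =>
    if h : ∃ i, ε ≤ a i then some h.choose else none
  have hidx : ∀ a i, idx a = some i → ε ≤ a i := by
    intro a i h
    simp only [idx] at h
    split_ifs at h with h'
    obtain rfl := Option.some_injective _ h
    exact h'.choose_spec
  let L : (Fin n → ℝ) → ℤ := fun y =>
    (idx fun i => |y i|).elim 0 fun i => (i + 1) * (SignType.sign (y i) : ℤ)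
  have hL : ∀ y, L y = 0 ∨ ∃ i : Fin n, ε ≤ |y i| ∧
      (0 < y i ∧ L y = i + 1 ∨ y i < 0 ∧ L y = -(i + 1)) := by
    intro y
    rcases hi : idx (fun i => |y i|) with _ | i
    · left
      simp [L, hi]
    · right
      have hy := hidx _ _ hi
      refine ⟨i, hy, ?_⟩
      rcases (abs_pos.1 (hε.trans_le hy)).lt_or_gt with h | h
      · right
        simp [L, hi, h]
      · left
        simp [L, hi, h]
  refine ⟨L, fun y => ?_, fun y => ?_, fun y hy => ?_, fun y z hy hyz => ?_⟩
  · simp only [L, Pi.neg_apply, abs_neg]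
    rcases idx (fun i => |y i|) with _ | i
    · simp
    · simp [Left.sign_neg]
  · rcases hL y with h | ⟨i, -, ⟨-, h⟩ | ⟨-, h⟩⟩ <;> omega
  · have hsome : idx (fun i => |y i|) = some hy.choose := by simp only [idx, dif_pos hy]
    have h0 : y hy.choose ≠ 0 := abs_pos.1 (hε.trans_le hy.choose_spec)
    simp only [L, hsome, Option.elim_some]
    refine mul_ne_zero (by positivity) ?_
    rcases h0.lt_or_gt with h | h <;> simp [h]
  · rcases hL y with h | ⟨i, hi, h⟩
    · exact absurd h hy
    rcases hL z with h' | ⟨j, hj, h'⟩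
    · omega
    have hij : i = j := by
      rcases h with ⟨-, h⟩ | ⟨-, h⟩ <;> rcases h' with ⟨-, h'⟩ | ⟨-, h'⟩ <;> omega
    subst hij
    refine ⟨i, ?_⟩
    rcases h with ⟨hp, h⟩ | ⟨hp, h⟩ <;> rcases h' with ⟨hq, h'⟩ | ⟨hq, h'⟩
    · omega
    · rw [abs_of_pos hp] at hi
      rw [abs_of_pos (by linarith)]
      linarith
    · rw [abs_of_neg hp] at hi
      rw [abs_of_neg (by linarith)]
      linarith
    · omega

/-- The **Borsuk–Ulam theorem**: an odd continuous map from the `n`-sphere to `ℝⁿ` has a zero. -/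
theorem borsuk_ulam {f : 𝔼 → Fin n → ℝ} (hf : ContinuousOn f (Metric.sphere 0 1))
    (hodd : ∀ x ∈ Metric.sphere (0 : 𝔼) 1, f (-x) = -f x) :
    ∃ x ∈ Metric.sphere (0 : 𝔼) 1, f x = 0 := by
  by_contra! hne
  let p : 𝔼 → 𝔼 := fun x => ‖x‖⁻¹ • x
  have hp : ∀ x : 𝔼, x ≠ 0 → p x ∈ Metric.sphere (0 : 𝔼) 1 := fun x hx => by
    simp [p, norm_smul, hx]
  let g : 𝔼 → Fin n → ℝ := fun x => if x = 0 then 0 else f (p x)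
  have hg : ∀ x, x ≠ 0 → g x = f (p x) := fun x hx => if_neg hx
  have hgodd : ∀ x, g (-x) = -g x := by
    intro x
    rcases eq_or_ne x 0 with rfl | hx
    · simp [g]
    · rw [hg x hx, hg (-x) (neg_ne_zero.2 hx), ← hodd _ (hp x hx)]
      simp [p]
  have hgc : ContinuousOn g (crossSphere n) := by
    have hpc : ContinuousOn p (crossSphere n) := fun x hx =>
      ((continuousAt_id.norm.inv₀ (norm_ne_zero_iff.2 (ne_zero_of_mem_crossSphere hx))).smul
        continuousAt_id).continuousWithinAt
    exact (hf.comp hpc fun x hx => hp x (ne_zero_of_mem_crossSphere hx)).congr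
      fun x hx => hg x (ne_zero_of_mem_crossSphere hx)
  have hg0 : ∀ x ∈ crossSphere n, g x ≠ 0 := fun x hx => by
    rw [hg x (ne_zero_of_mem_crossSphere hx)]
    exact hne _ (hp x (ne_zero_of_mem_crossSphere hx))
  obtain ⟨ε, hε, hgε⟩ : ∃ ε > 0, ∀ x ∈ crossSphere n, ε ≤ ‖g x‖ :=
    isCompact_crossSphere.exists_forall_le' hgc.norm fun x hx => norm_pos_iff.2 (hg0 x hx)
  have hbig : ∀ x ∈ crossSphere n, ∃ i, ε ≤ |g x i| := by
    intro x hx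
    by_contra! h
    exact (hgε x hx).not_gt ((pi_norm_lt_iff hε).2 h)
  obtain ⟨δ, hδ, hgδ⟩ := Metric.uniformContinuousOn_iff.1
    (isCompact_crossSphere.uniformContinuousOn_of_continuous hgc) ε hε
  obtain ⟨L, hLodd, hLn, hL0, hL⟩ := exists_odd_labelling n hε
  obtain ⟨u, hu, v, hv, huv, h⟩ := exists_opposite_labels (lab := L ∘ g)
    (fun x => by simp [hgodd, hLodd]) (fun x hx => hL0 _ (hbig x hx)) (fun x => hLn _) hδ
  obtain ⟨i, hi⟩ := hL _ _ (hL0 _ (hbig u hu)) h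
  refine (hgδ u hu v hv huv).not_ge (hi.trans ?_)
  rw [dist_eq_norm]
  exact norm_le_pi_norm (g u - g v) i

end CrossPolytope

/-- A function supported on at most `k + 2` points cannot exceed a nonnegative function at
`2 * k + 1` points. -/
lemma not_forall_lt_of_ncard_support_le {k : ℕ} (hk : 2 ≤ k) {p q : Fin (2 * k + 2) → ℝ}
    (hq : ∀ i, 0 ≤ q i) (hcard : (Function.support p).ncard ≤ k + 2) :
    ¬ ∀ i : Fin (2 * k + 1), q i.castSucc < p i.castSucc := by
  intro h
  have hsub : range (Fin.castSucc : Fin (2 * k + 1) → Fin (2 * k + 2)) ⊆ Function.support p := by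
    rintro _ ⟨i, rfl⟩
    exact ((hq _).trans_lt (h i)).ne'
  have := Set.ncard_le_ncard hsub
  rw [Set.ncard_range_of_injective (Fin.castSucc_injective _), Nat.card_fin] at this
  omega

/-- The deleted square misses the points whose coordinate difference is constant on the first
`2 * k + 1` vertices. -/
lemma not_forall_sub_eq_of_mem_deletedSquare {k : ℕ} (hk : 2 ≤ k)
    {p : (Fin (2 * k + 2) → ℝ) × (Fin (2 * k + 2) → ℝ)}
    (hp : p ∈ deletedSquare (2 * k + 2) (k + 1)) (a : ℝ) :
    ¬ ∀ i : Fin (2 * k + 1), p.1 i.castSucc - p.2 i.castSucc = a := by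
  obtain ⟨⟨h1, h1s⟩, ⟨h2, h2s⟩, hdisj, hc1, hc2⟩ := hp
  intro h
  rcases lt_trichotomy a 0 with ha | rfl | ha
  · exact not_forall_lt_of_ncard_support_le hk h1 hc2 fun i => by linarith [h i]
  · have heq : ∀ i, p.1 i = p.2 i := by
      intro i
      induction i using Fin.lastCases with
      | cast i => exact sub_eq_zero.1 (h i)
      | last =>
        rw [Fin.sum_univ_castSucc] at h1s h2s
        have : ∑ i : Fin (2 * k + 1), p.1 i.castSucc = ∑ i : Fin (2 * k + 1), p.2 i.castSucc :=
          Finset.sum_congr rfl fun i _ => sub_eq_zero.1 (h i)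
        linarith
    rw [← funext heq, disjoint_self, Set.bot_eq_empty, Function.support_eq_empty_iff] at hdisj
    simp [hdisj] at h1s
  · exact not_forall_lt_of_ncard_support_le hk h2 hc1 fun i => by linarith [h i]

/-- For every `k ≥ 2` there is no continuous `ℤ/2`-equivariant map from the sphere
`S^{2k}` (unit sphere in `ℝ^{2k+1}`, with the antipodal action) to the deleted
square of the `(k+1)`-dimensional skeleton of the `(2k+1)`-dimensional simplex
(with the factor-swapping action). -/
theorem no_equivariant_map_to_deleted_square_even (k : ℕ) (hk : 2 ≤ k) :
    ¬ ∃ F : EuclideanSpace ℝ (Fin (2 * k + 1)) → (Fin (2 * k + 2) → ℝ) × (Fin (2 * k + 2) → ℝ),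
      ContinuousOn F (Metric.sphere 0 1) ∧
      (∀ x ∈ Metric.sphere (0 : EuclideanSpace ℝ (Fin (2 * k + 1))) 1,
        F x ∈ deletedSquare (2 * k + 2) (k + 1)) ∧
      (∀ x ∈ Metric.sphere (0 : EuclideanSpace ℝ (Fin (2 * k + 1))) 1,
        F (-x) = Prod.swap (F x)) := by
  rintro ⟨F, hFc, hF, hFs⟩
  let i₀ : Fin (2 * k) → Fin (2 * k + 2) := fun i => ⟨i, by omega⟩
  let i₁ : Fin (2 * k) → Fin (2 * k + 2) := fun i => ⟨i + 1, by omega⟩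
  let d : EuclideanSpace ℝ (Fin (2 * k + 1)) → Fin (2 * k + 2) → ℝ := fun x => (F x).1 - (F x).2
  obtain ⟨x, hx, h0⟩ := borsuk_ulam (n := 2 * k) (f := fun x i => d x (i₀ i) - d x (i₁ i))
    (by
      refine continuousOn_pi.2 fun i => ?_
      have h1 := continuousOn_pi.1 (hFc.fst.sub hFc.snd)
      exact (h1 (i₀ i)).sub (h1 (i₁ i)))
    (fun x hx => by
      ext i
      simp only [d, hFs x hx, Prod.fst_swap, Prod.snd_swap, Pi.sub_apply, Pi.neg_apply]
      ring)
  have hstep : ∀ i, d x (i₀ i) = d x (i₁ i) := fun i => sub_eq_zero.1 (congrFun h0 i)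
  refine not_forall_sub_eq_of_mem_deletedSquare hk (hF x hx) (d x 0) fun i => ?_
  induction i using Fin.induction with
  | zero => rfl
  | succ i ih => exact (hstep i).symm.trans ih
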